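/- Let $b \geq 2$ be an integer and $s_b(n)$ the sum of the base-$b$ digits of $n$. Then $\lim_{k \to \infty} \sum_{n \geq 1,\ s_b(n) = k} \frac{1}{n} = \frac{2 \log b}{b-1}$. -/

import Mathlib

open Filter Topology

/-- averaging recurrences converge -/
lemma conv_aux (r K : ℕ) (hr : 1 ≤ r) (v : ℕ → ℝ)
    (h : ∀ k ≥ K, ∑ i ∈ Finset.range r, ((i : ℝ) + 1) * v (k + i) = 0) :
    Tendsto v atTop (𝓝 0) := by
  have hrec : ∀ k ≥ K, r * v (k + r) = ∑ i ∈ Finset.range r, v (k + i) := by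
    intro k hk
    have h1 := h (k + 1) (by omega)
    have h0 := h k hk
    have e1 : ∑ i ∈ Finset.range (r+1), (i : ℝ) * v (k + i) = 0 := by
      rw [Finset.sum_range_succ']
      simp only [Nat.cast_zero, zero_mul, add_zero]
      rw [← h1]
      refine Finset.sum_congr rfl fun i _ => ?_
      push_cast
      rw [show k + (i + 1) = k + 1 + i by ring]
    rw [Finset.sum_range_succ] at e1
    have e2 : ∑ i ∈ Finset.range r, ((i : ℝ) + 1) * v (k + i)
        = ∑ i ∈ Finset.range r, (i : ℝ) * v (k + i) + ∑ i ∈ Finset.range r, v (k + i) := by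
      rw [← Finset.sum_add_distrib]
      exact Finset.sum_congr rfl fun i _ => by ring
    linarith
  have hr0 : (0 : ℝ) < r := by exact_mod_cast hr
  set q : ℝ := 1 - 1 / r with hq
  have hq0 : 0 ≤ q := by
    have : (1 : ℝ) / r ≤ 1 := by
      rw [div_le_one hr0]; exact_mod_cast hr
    linarith
  have hq1 : q < 1 := by
    have : 0 < (1 : ℝ) / r := by positivity
    linarith
  -- one-sided step
  have step : ∀ w : ℕ → ℝ, (∀ k ≥ K, ∑ i ∈ Finset.range r, ((i : ℝ) + 1) * w (k + i) = 0) →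
      (∀ k ≥ K, r * w (k + r) = ∑ i ∈ Finset.range r, w (k + i)) →
      ∀ C : ℝ, 0 ≤ C → ∀ k ≥ K, (∀ i < r, w (k + i) ≤ C) → w (k + r) ≤ q * C := by
    intro w hw hwr C hC k hk hb
    obtain ⟨i, hi, hi0⟩ : ∃ i ∈ Finset.range r, w (k + i) ≤ 0 := by
      by_contra! hcon
      have : 0 < ∑ i ∈ Finset.range r, ((i : ℝ) + 1) * w (k + i) := by
        apply Finset.sum_pos
        · intro i hi
          have := hcon i hi
          positivity
        · exact ⟨0, by simp; omega⟩
      linarith [hw k hk]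
    have hs : ∑ j ∈ Finset.range r, w (k + j) ≤ (r - 1) * C := by
      rw [← Finset.add_sum_erase _ _ hi]
      have : ∑ j ∈ (Finset.range r).erase i, w (k + j) ≤ ((Finset.range r).erase i).card • C := by
        apply Finset.sum_le_card_nsmul
        intro j hj
        exact hb j (by simpa using (Finset.mem_of_mem_erase hj))
      rw [Finset.card_erase_of_mem hi, Finset.card_range, nsmul_eq_mul, Nat.cast_sub hr] at this
      push_cast at this
      linarith
    rw [← hwr k hk] at hs
    have : r * (q * C) = (r - 1) * C := by
      rw [hq]; field_simp
    rw [← mul_le_mul_iff_right₀ hr0]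
    linarith
  have step2 : ∀ C : ℝ, 0 ≤ C → ∀ k ≥ K, (∀ i < r, |v (k + i)| ≤ C) → |v (k + r)| ≤ q * C := by
    intro C hC k hk hb
    rw [abs_le]
    constructor
    · have := step (fun n => - v n) (by
        intro k hk
        have := h k hk
        simp [this]) (by
        intro k hk
        have := hrec k hk
        simp [this]) C hC k hk (fun i hi => by have := (abs_le.1 (hb i hi)).1; simp; linarith)
      have h' : -v (k + r) ≤ q * C := this
      linarith
    · exact step v h hrec C hC k hk (fun i hi => (abs_le.1 (hb i hi)).2)
  have step3 : ∀ C : ℝ, 0 ≤ C → ∀ N ≥ K, (∀ i < r, |v (N + i)| ≤ C) →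
      ∀ n, |v (N + n)| ≤ C := by
    intro C hC N hN hb n
    induction n using Nat.strong_induction_on with
    | _ n ih =>
      by_cases hn : n < r
      · exact hb n hn
      · obtain ⟨m, rfl⟩ := Nat.exists_eq_add_of_le (not_lt.1 hn)
        have := step2 C hC (N + m) (by omega) (fun i hi => by
          have := ih (m + i) (by omega)
          rwa [← add_assoc] at this)
        rw [show N + (r + m) = N + m + r by ring]
        nlinarith
  set C : ℝ := ∑ i ∈ Finset.range r, |v (K + i)| with hC
  have hC0 : 0 ≤ C := Finset.sum_nonneg fun i _ => abs_nonneg _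
  have main : ∀ n : ℕ, ∀ j, |v (K + n * r + j)| ≤ q ^ n * C := by
    intro n
    induction n with
    | zero =>
      intro j
      have := step3 C hC0 K le_rfl (fun i hi => by
        exact Finset.single_le_sum (f := fun i => |v (K + i)|) (fun i _ => abs_nonneg _)
          (Finset.mem_range.2 hi)) j
      simpa using this
    | succ n ih =>
      intro j
      have := step2 (q ^ n * C) (by positivity) (K + n * r + j) (by
        have := Nat.zero_le (n * r); omega) (fun i hi => by
        have := ih (j + i)
        rwa [← add_assoc] at this)
      rw [show K + (n + 1) * r + j = K + n * r + j + r by ring, pow_succ]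
      linarith
  rw [Metric.tendsto_atTop]
  intro ε hε
  have hlim : Tendsto (fun n : ℕ => q ^ n * C) atTop (𝓝 0) := by
    simpa using (tendsto_pow_atTop_nhds_zero_of_lt_one hq0 hq1).mul_const C
  obtain ⟨n, hn⟩ := (hlim.eventually (gt_mem_nhds hε)).exists
  refine ⟨K + n * r, fun m hm => ?_⟩
  obtain ⟨j, rfl⟩ := Nat.exists_eq_add_of_le hm
  rw [Real.dist_eq, sub_zero]
  exact (main n j).trans_lt hn

lemma sum_succ_cast (r : ℕ) : ∑ i ∈ Finset.range r, ((i : ℝ) + 1) = r * (r + 1) / 2 := by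
  induction r with
  | zero => simp
  | succ n ih => rw [Finset.sum_range_succ, ih]; push_cast; ring

lemma conv_main (r K : ℕ) (hr : 1 ≤ r) (u : ℕ → ℝ) (I : ℝ)
    (h : ∀ k ≥ K, ∑ i ∈ Finset.range r, ((i : ℝ) + 1) * u (k + i) = I) :
    Tendsto u atTop (𝓝 (2 * I / (r * (r + 1)))) := by
  have hr0 : (0 : ℝ) < r := by exact_mod_cast hr
  have := conv_aux r K hr (fun k => u k - 2 * I / (r * (r + 1))) (by
    intro k hk
    simp only [mul_sub, Finset.sum_sub_distrib]
    rw [h k hk, ← Finset.sum_mul, sum_succ_cast]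
    field_simp
    ring)
  have h2 := this.add_const (2 * I / (r * (r + 1)))
  simpa using h2

lemma sum_range_block (b N : ℕ) (φ : ℕ → ℝ) :
    ∑ n ∈ Finset.range (b * N), φ n
      = ∑ n ∈ Finset.range N, ∑ d ∈ Finset.range b, φ (b * n + d) := by
  induction N with
  | zero => simp
  | succ N ih => rw [Nat.mul_succ, Finset.sum_range_add, ih, Finset.sum_range_succ]

lemma dig_step (b : ℕ) (hb : 2 ≤ b) (n d : ℕ) (hd : d < b) :
    (Nat.digits b (b * n + d)).sum = (Nat.digits b n).sum + d := by
  by_cases h : n = 0 ∧ d = 0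
  · obtain ⟨rfl, rfl⟩ := h; simp
  · rw [add_comm (b * n) d, Nat.digits_add b (by omega) d n hd (by omega)]
    simp [add_comm]

/-- log sums -/
lemma log_sum (b : ℕ) (hb : 2 ≤ b) :
    Tendsto (fun J : ℕ => ∑ n ∈ Finset.range (b ^ (J + 1)), (1 : ℝ) / n
      - ∑ n ∈ Finset.range (b ^ J), (1 : ℝ) / n) atTop (𝓝 (Real.log b)) := by
  have h1 := Real.tendsto_harmonic_sub_log
  have h2 : Tendsto (fun N : ℕ => ∑ n ∈ Finset.range N, (1 : ℝ) / n - Real.log N) atTop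
      (𝓝 Real.eulerMascheroniConstant) := by
    have h3 : Tendsto (fun n : ℕ => (1 : ℝ) / n) atTop (𝓝 0) := tendsto_one_div_atTop_nhds_zero_nat
    have := h1.sub h3
    rw [sub_zero] at this
    refine this.congr fun N => ?_
    have e : (harmonic N : ℝ) = ∑ n ∈ Finset.range (N + 1), (1 : ℝ) / n := by
      rw [Finset.sum_range_succ']
      simp [harmonic]
    rw [e, Finset.sum_range_succ]
    ring
  have hp : Tendsto (fun J : ℕ => b ^ J) atTop atTop :=
    tendsto_pow_atTop_atTop_of_one_lt (by omega)
  have h4 := h2.comp hp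
  have h5 := h4.comp (tendsto_add_atTop_nat 1)
  have h6 := (h5.sub h4).add_const (Real.log b)
  rw [sub_self, zero_add] at h6
  refine h6.congr fun J => ?_
  simp only [Function.comp]
  push_cast
  rw [Real.log_pow, Real.log_pow]
  push_cast
  ring

lemma bdd_aux (b : ℕ) (hb : 2 ≤ b) (k : ℕ) : ∃ B : ℝ, 0 ≤ B ∧ ∀ N : ℕ,
    ∑ n ∈ Finset.range N, (if (Nat.digits b n).sum = k then (1 : ℝ) / n else 0) ≤ B := by
  induction k using Nat.strong_induction_on with
  | _ k ih =>
    choose! B hB0 hB using ih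
    have hb0 : (0 : ℝ) < b := by positivity
    have hb2 : (2 : ℝ) ≤ b := by exact_mod_cast hb
    set T : ℝ := ∑ d ∈ Finset.range (b - 1), (if d + 1 ≤ k then B (k - (d + 1)) else 0) with hT
    have hT0 : 0 ≤ T := Finset.sum_nonneg fun d _ => by
      split_ifs with h
      · exact hB0 _ (by omega)
      · exact le_rfl
    refine ⟨(b * b + T), by positivity, fun N => ?_⟩
    set H : ℝ := ∑ n ∈ Finset.range N, (if (Nat.digits b n).sum = k then (1 : ℝ) / n else 0)
      with hH
    have h1 : H ≤ ∑ n ∈ Finset.range (b * N),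
        (if (Nat.digits b n).sum = k then (1 : ℝ) / n else 0) := by
      apply Finset.sum_le_sum_of_subset_of_nonneg
      · intro n hn
        simp only [Finset.mem_range] at *
        nlinarith
      · intro n _ _
        split_ifs <;> positivity
    rw [sum_range_block] at h1
    have h2 : ∑ n ∈ Finset.range N, ∑ d ∈ Finset.range b,
        (if (Nat.digits b (b * n + d)).sum = k then (1 : ℝ) / (b * n + d : ℕ) else 0)
        ≤ ∑ n ∈ Finset.range N, ∑ d ∈ Finset.range b,
        ((if n = 0 then 1 else 0) +
          1 / b * (if (Nat.digits b n).sum + d = k then (1 : ℝ) / n else 0)) := by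
      refine Finset.sum_le_sum fun n _ => Finset.sum_le_sum fun d hd => ?_
      rw [dig_step b hb n d (Finset.mem_range.1 hd)]
      by_cases hn : n = 0
      · subst hn
        have : (1 : ℝ) / (d : ℕ) ≤ 1 := by
          rcases Nat.eq_zero_or_pos d with rfl | h
          · simp
          · rw [div_le_one (by positivity)]; exact_mod_cast h
        split_ifs <;> simp at * <;> linarith
      · have : (0 : ℝ) < n := by positivity
        have h3 : (1 : ℝ) / (b * n + d : ℕ) ≤ 1 / b * (1 / n) := by
          rw [one_div_mul_one_div]
          push_cast
          apply one_div_le_one_div_of_le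
          · positivity
          · nlinarith [Nat.cast_nonneg (α := ℝ) d]
        split_ifs <;> simp at * <;> linarith
    have h3 : ∑ n ∈ Finset.range N, ∑ d ∈ Finset.range b,
        (((if n = 0 then 1 else 0) : ℝ) +
          1 / b * (if (Nat.digits b n).sum + d = k then (1 : ℝ) / n else 0))
        ≤ b + 1 / b * (T + H) := by
      simp only [Finset.sum_add_distrib]
      apply add_le_add
      · simp only [Finset.sum_const, Finset.card_range, nsmul_eq_mul, ← Finset.mul_sum]
        rw [Finset.sum_ite_eq']
        split_ifs <;> simp
      · rw [Finset.sum_comm]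
        simp only [← Finset.mul_sum]
        apply mul_le_mul_of_nonneg_left _ (by positivity)
        obtain ⟨r, rfl⟩ : ∃ r, b = r + 1 := ⟨b - 1, by omega⟩
        rw [Finset.sum_range_succ']
        simp only [add_zero]
        refine add_le_add ?_ le_rfl
        rw [hT]
        simp only [Nat.add_sub_cancel]
        refine Finset.sum_le_sum fun d _ => ?_
        split_ifs with hd
        · refine le_trans (le_of_eq ?_) (hB (k - (d + 1)) (by omega) N)
          refine Finset.sum_congr rfl fun n _ => ?_
          congr 1
          apply propext
          omega
        · apply le_of_eq
          refine Finset.sum_eq_zero fun n _ => ?_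
          rw [if_neg (by omega)]
    have h4 : H ≤ b + 1 / b * (T + H) := h1.trans (h2.trans h3)
    have h5 : b * H ≤ b * b + (T + H) := by
      have := mul_le_mul_of_nonneg_left h4 hb0.le
      rw [mul_add, ← mul_assoc (b : ℝ) (1 / b), mul_one_div_cancel hb0.ne', one_mul] at this
      exact this
    have hH0 : 0 ≤ H := Finset.sum_nonneg fun n _ => by split_ifs <;> positivity
    nlinarith

lemma summ_inv (b : ℕ) (hb : 2 ≤ b) (k : ℕ) :
    Summable (fun n : ℕ => if (Nat.digits b n).sum = k then (1 : ℝ) / n else 0) := by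
  obtain ⟨B, -, hB⟩ := bdd_aux b hb k
  exact summable_of_sum_range_le (fun n => by split_ifs <;> positivity) hB

lemma renewal (r : ℕ) (hr : 1 ≤ r) (f : ℕ → ℝ) (M : ℕ)
    (hs : ∀ k, Summable (fun n : ℕ => if (Nat.digits (r + 1) n).sum = k then f n else 0))
    (hf : ∀ n, (r + 1) * M ≤ n → f n = f (n / (r + 1)) / (r + 1 : ℕ)) :
    Tendsto (fun k => ∑' n : ℕ, if (Nat.digits (r + 1) n).sum = k then f n else 0) atTop
      (𝓝 (2 / r * (∑ n ∈ Finset.range ((r + 1) * M), f n - ∑ n ∈ Finset.range M, f n))) := by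
  set s : ℕ → ℕ := fun n => (Nat.digits (r + 1) n).sum with hsdef
  have hr0 : (0 : ℝ) < r := by exact_mod_cast hr
  set b := r + 1 with hbdef
  have hb2 : 2 ≤ b := by omega
  have hb0 : (0 : ℝ) < (b : ℝ) := by positivity
  set u : ℕ → ℝ := fun k => ∑' n : ℕ, if s n + b = k then f n else 0 with hu
  have hs' : ∀ k, Summable (fun n : ℕ => if s n + b = k then f n else 0) := by
    intro k
    by_cases hk : b ≤ k
    · refine (hs (k - b)).congr fun n => ?_
      congr 1
      apply propext
      simp only [hsdef]
      omega
    · refine summable_zero.congr fun n => ?_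
      rw [if_neg (by omega)]
  have hu0 : ∀ k < b, u k = 0 := by
    intro k hk
    have : (fun n : ℕ => if s n + b = k then f n else 0) = fun _ => 0 := by
      funext n
      rw [if_neg (by omega)]
    simp only [hu, this, tsum_zero]
  set G : ℕ → ℝ := fun k => ∑ n ∈ Finset.range (b * M),
    if s n + b = k then f n - f (n / b) / b else 0 with hG
  have hrec : ∀ k, u (k + r) = G (k + r) + 1 / b * ∑ i ∈ Finset.range b, u (k + i) := by
    intro k
    have t0 : ∀ k, Tendsto (fun N => ∑ n ∈ Finset.range N, if s n + b = k then f n else 0)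
        atTop (𝓝 (u k)) := fun k => (hs' k).hasSum.tendsto_sum_nat
    have tb : Tendsto (fun N : ℕ => b * N) atTop atTop :=
      tendsto_id.const_mul_atTop' (by omega)
    have t1 := (t0 (k + r)).comp tb
    have t2 : Tendsto (fun N => G (k + r) + 1 / b * ∑ i ∈ Finset.range b,
        ∑ n ∈ Finset.range N, if s n + b = k + i then f n else 0) atTop
        (𝓝 (G (k + r) + 1 / b * ∑ i ∈ Finset.range b, u (k + i))) := by
      apply Tendsto.const_add
      apply Tendsto.const_mul
      exact tendsto_finsetSum _ fun i _ => t0 (k + i)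
    refine tendsto_nhds_unique t1 (t2.congr' ?_)
    filter_upwards [eventually_ge_atTop M] with N hN
    simp only [Function.comp]
    have e1 : ∑ n ∈ Finset.range (b * N), (if s n + b = k + r then f n else 0)
        = ∑ n ∈ Finset.range (b * N), (if s n + b = k + r then f n - f (n / b) / b else 0)
          + ∑ n ∈ Finset.range (b * N), (if s n + b = k + r then f (n / b) / b else 0) := by
      rw [← Finset.sum_add_distrib]
      refine Finset.sum_congr rfl fun n _ => ?_
      split_ifs <;> ring
    have e2 : G (k + r) = ∑ n ∈ Finset.range (b * N),
        (if s n + b = k + r then f n - f (n / b) / b else 0) := by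
      refine Finset.sum_subset ?_ ?_
      · intro n hn
        simp only [Finset.mem_range] at *
        exact lt_of_lt_of_le hn (Nat.mul_le_mul_left b hN)
      · intro n _ hn
        rw [Finset.mem_range, not_lt] at hn
        rw [hf n hn]
        simp
    rw [e1, ← e2, sum_range_block]
    congr 1
    rw [← Finset.sum_range_reflect, Finset.mul_sum, Finset.sum_comm]
    refine Finset.sum_congr rfl fun d hd => ?_
    rw [Finset.mem_range] at hd
    rw [Finset.mul_sum]
    refine Finset.sum_congr rfl fun n _ => ?_
    have e3 : s (b * n + d) = s n + d := dig_step b hb2 n d hd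
    have e4 : (b * n + d) / b = n := by
      rw [Nat.mul_add_div (by omega), Nat.div_eq_of_lt hd, add_zero]
    rw [e3, e4]
    by_cases hc : s n + d + b = k + r
    · rw [if_pos hc, if_pos (by omega)]; ring
    · rw [if_neg hc, if_neg (by omega)]; ring
  have hI : ∀ K, ∑ i ∈ Finset.range r, ((i : ℝ) + 1) * u (K + i)
      = b * ∑ k ∈ Finset.range K, G (k + r) := by
    intro K
    induction K with
    | zero =>
      simp only [Finset.range_zero, Finset.sum_empty, mul_zero]
      refine Finset.sum_eq_zero fun i hi => ?_
      rw [Finset.mem_range] at hi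
      rw [hu0 _ (by omega), mul_zero]
    | succ K ih =>
      rw [Finset.sum_range_succ, mul_add, ← ih]
      have h1 := hrec K
      have h2 : b * u (K + r) = b * G (K + r) + ∑ i ∈ Finset.range b, u (K + i) := by
        rw [h1]; field_simp
      have e1 : ∑ i ∈ Finset.range b, (i : ℝ) * u (K + i)
          = ∑ i ∈ Finset.range r, ((i : ℝ) + 1) * u (K + 1 + i) := by
        rw [hbdef, Finset.sum_range_succ']
        simp only [Nat.cast_zero, zero_mul, add_zero]
        refine Finset.sum_congr rfl fun i _ => ?_
        push_cast
        rw [show K + (i + 1) = K + 1 + i by ring]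
      have e2 : ∑ i ∈ Finset.range r, ((i : ℝ) + 1) * u (K + i)
          = ∑ i ∈ Finset.range r, (i : ℝ) * u (K + i) + ∑ i ∈ Finset.range r, u (K + i) := by
        rw [← Finset.sum_add_distrib]
        exact Finset.sum_congr rfl fun i _ => by ring
      rw [← e1, e2]
      rw [hbdef, Finset.sum_range_succ] at h2 ⊢
      push_cast at h2 ⊢
      linarith
  set I : ℝ := b * (∑ n ∈ Finset.range (b * M), f n - ∑ n ∈ Finset.range M, f n) with hIdef
  obtain ⟨K0, hK0⟩ : ∃ K0, ∀ n ∈ Finset.range (b * M), s n + b ≤ K0 :=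
    ⟨∑ n ∈ Finset.range (b * M), (s n + b), fun n hn =>
      Finset.single_le_sum (f := fun n => s n + b) (fun _ _ => Nat.zero_le _) hn⟩
  have hfin : ∀ K ≥ K0 + 1, ∑ i ∈ Finset.range r, ((i : ℝ) + 1) * u (K + i) = I := by
    intro K hK
    rw [hI, hIdef]
    congr 1
    simp only [hG]
    rw [Finset.sum_comm]
    have e1 : ∀ n ∈ Finset.range (b * M), (∑ k ∈ Finset.range K,
        if s n + b = k + r then f n - f (n / b) / b else 0) = f n - f (n / b) / b := by
      intro n hn
      have := hK0 n hn
      rw [Finset.sum_eq_single (s n + 1)]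
      · rw [if_pos (by omega)]
      · intro k _ hk
        rw [if_neg (by omega)]
      · intro h
        exact absurd (Finset.mem_range.2 (by omega)) h
    rw [Finset.sum_congr rfl e1, Finset.sum_sub_distrib]
    congr 1
    rw [sum_range_block]
    refine Finset.sum_congr rfl fun n _ => ?_
    have e2 : ∀ d ∈ Finset.range b, f ((b * n + d) / b) / b = f n / b := by
      intro d hd
      rw [Finset.mem_range] at hd
      rw [Nat.mul_add_div (by omega), Nat.div_eq_of_lt hd, add_zero]
    rw [Finset.sum_congr rfl e2]
    simp
    field_simp
  have hlim := (conv_main r (K0 + 1) hr u I hfin).comp (tendsto_add_atTop_nat b)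
  have hval : 2 * I / (r * (r + 1))
      = 2 / r * (∑ n ∈ Finset.range (b * M), f n - ∑ n ∈ Finset.range M, f n) := by
    rw [hIdef, hbdef]
    push_cast
    field_simp
  rw [hval] at hlim
  refine hlim.congr fun k => ?_
  simp only [Function.comp, hu, add_left_inj]
  rfl

/-- the piecewise approximation of `1/n` obtained by keeping the first `J + 1` digits -/
noncomputable def apx (b J n : ℕ) : ℝ :=
  1 / ((n / b ^ (Nat.log b n - J) * b ^ (Nat.log b n - J) : ℕ) : ℝ)

lemma apx_small (b J n : ℕ) (hb : 2 ≤ b) (hn : n < b ^ (J + 1)) : apx b J n = 1 / n := by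
  have : Nat.log b n - J = 0 := by
    have := Nat.log_lt_of_lt_pow' (b := b) (x := J + 1) (y := n) (by omega) hn
    omega
  simp [apx, this]

lemma apx_rec (b J n : ℕ) (hb : 2 ≤ b) (hn : b ^ (J + 1) ≤ n) :
    apx b J n = apx b J (n / b) / b := by
  have h1 : J + 1 ≤ Nat.log b n := Nat.le_log_of_pow_le (by omega) hn
  have h2 : Nat.log b (n / b) = Nat.log b n - 1 := Nat.log_div_base b n
  obtain ⟨m, hm⟩ : ∃ m, Nat.log b n = J + 1 + m := ⟨_, (Nat.add_sub_cancel' h1).symm⟩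
  unfold apx
  rw [h2, hm, show J + 1 + m - J = m + 1 by omega, show J + 1 + m - 1 - J = m by omega,
    pow_succ', ← Nat.div_div_eq_div_mul]
  push_cast
  rw [div_div]
  congr 1
  ring

lemma apx_ge (b J n : ℕ) (hb : 2 ≤ b) : 1 / (n : ℝ) ≤ apx b J n := by
  rcases Nat.eq_zero_or_pos n with rfl | hn
  · simp [apx]
  · unfold apx
    apply one_div_le_one_div_of_le
    · norm_cast
      apply Nat.mul_pos
      · apply Nat.div_pos
        · exact (Nat.pow_le_pow_right (by omega) (Nat.sub_le _ _)).trans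
            (Nat.pow_log_le_self b (by omega))
        · positivity
      · positivity
    · exact_mod_cast Nat.div_mul_le_self _ _

lemma apx_le (b J n : ℕ) (hb : 2 ≤ b) : apx b J n ≤ (1 + 1 / (b : ℝ) ^ J) * (1 / n) := by
  have hb0 : (0 : ℝ) < b := by positivity
  have hc : 0 ≤ 1 / (b : ℝ) ^ J := by positivity
  by_cases hsm : n < b ^ (J + 1)
  · rw [apx_small b J n hb hsm]
    have : 0 ≤ 1 / (n : ℝ) := by positivity
    nlinarith
  · rw [not_lt] at hsm
    have hn : 0 < n := lt_of_lt_of_le (by positivity) hsm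
    have h1 : J + 1 ≤ Nat.log b n := Nat.le_log_of_pow_le (by omega) hsm
    unfold apx
    set m := Nat.log b n - J with hm
    set p := n / b ^ m with hp
    have hpow : 0 < b ^ m := by positivity
    have hpJ : b ^ J ≤ p := by
      rw [hp, Nat.le_div_iff_mul_le hpow, ← pow_add, show J + m = Nat.log b n by omega]
      exact Nat.pow_log_le_self b (by omega)
    have hlt : n < (p + 1) * b ^ m := by
      have := Nat.lt_div_mul_add (a := n) hpow
      rw [add_mul, one_mul]
      exact this
    have hpJ' : (b : ℝ) ^ J ≤ p := by exact_mod_cast hpJ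
    have hlt' : (n : ℝ) ≤ (p + 1) * (b : ℝ) ^ m := by exact_mod_cast hlt.le
    have hJ0 : (0 : ℝ) < (b : ℝ) ^ J := by positivity
    have hp0 : (0 : ℝ) < p := lt_of_lt_of_le hJ0 hpJ'
    have hn0 : (0 : ℝ) < n := by exact_mod_cast hn
    have hm0 : (0 : ℝ) < (b : ℝ) ^ m := by positivity
    push_cast
    rw [mul_one_div, div_le_div_iff₀ (by positivity) hn0, one_mul]
    refine hlt'.trans ?_
    rw [← mul_assoc]
    apply mul_le_mul_of_nonneg_right _ hm0.le
    have : 1 ≤ 1 / (b : ℝ) ^ J * p := by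
      rw [one_div_mul_eq_div, one_le_div hJ0]
      exact hpJ'
    linarith

theorem kempner_limit_base_b (b : ℕ) (hb : 2 ≤ b) :
    Filter.Tendsto
      (fun k : ℕ => ∑' n : ℕ, if (Nat.digits b n).sum = k then (1 : ℝ) / n else 0)
      Filter.atTop (nhds (2 * Real.log b / (b - 1))) := by
  have hb0 : (0 : ℝ) < b := by positivity
  have hb1 : (1 : ℝ) < b := by exact_mod_cast hb
  set D : ℕ → ℝ := fun J => ∑ n ∈ Finset.range (b ^ (J + 1)), (1 : ℝ) / n
      - ∑ n ∈ Finset.range (b ^ J), (1 : ℝ) / n with hD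
  have hDlim : Tendsto (fun J => 2 / ((b : ℝ) - 1) * D J) atTop
      (𝓝 (2 * Real.log b / (b - 1))) := by
    have := (log_sum b hb).const_mul (2 / ((b : ℝ) - 1))
    rwa [div_mul_eq_mul_div] at this
  have hq : Tendsto (fun J : ℕ => 1 + 1 / (b : ℝ) ^ J) atTop (𝓝 1) := by
    have := (tendsto_pow_atTop_nhds_zero_of_lt_one (r := 1 / (b : ℝ)) (by positivity)
      (by rw [div_lt_one hb0]; exact hb1)).const_add 1
    simpa using this
  have hDlim2 : Tendsto (fun J => 2 / ((b : ℝ) - 1) * D J / (1 + 1 / (b : ℝ) ^ J)) atTop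
      (𝓝 (2 * Real.log b / (b - 1))) := by
    have := hDlim.div hq one_ne_zero
    rwa [div_one] at this
  have hsum : ∀ J k, Summable
      (fun n : ℕ => if (Nat.digits b n).sum = k then apx b J n else 0) := by
    intro J k
    refine Summable.of_nonneg_of_le (fun n => ?_) (fun n => ?_)
      ((summ_inv b hb k).mul_left (1 + 1 / (b : ℝ) ^ J))
    · split_ifs
      · unfold apx; positivity
      · exact le_rfl
    · split_ifs
      · exact apx_le b J n hb
      · simp
  have hW : ∀ J, Tendsto (fun k => ∑' n : ℕ, if (Nat.digits b n).sum = k then apx b J n else 0)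
      atTop (𝓝 (2 / ((b : ℝ) - 1) * D J)) := by
    intro J
    obtain ⟨r, rfl⟩ : ∃ r, b = r + 1 := ⟨b - 1, by omega⟩
    have := renewal r (by omega) (apx (r + 1) J) ((r + 1) ^ J) (hsum J) (by
      intro n hn
      rw [← pow_succ'] at hn
      exact apx_rec (r + 1) J n hb hn)
    rw [← pow_succ'] at this
    convert this using 2
    congr 1
    · push_cast; ring
    · rw [hD]
      dsimp only
      congr 1
      · refine Finset.sum_congr rfl fun n hn => ?_
        exact (apx_small _ _ _ hb (Finset.mem_range.1 hn)).symm
      · refine Finset.sum_congr rfl fun n hn => ?_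
        exact (apx_small _ _ _ hb ((Finset.mem_range.1 hn).trans_le
          (Nat.pow_le_pow_right (by omega) (Nat.le_succ J)))).symm
  rw [tendsto_order]
  constructor
  · intro a ha
    obtain ⟨J, hJ⟩ := (hDlim2.eventually (lt_mem_nhds ha)).exists
    have hc : 0 < 1 + 1 / (b : ℝ) ^ J := by positivity
    rw [lt_div_iff₀ hc] at hJ
    filter_upwards [(hW J).eventually (lt_mem_nhds hJ)] with k hk
    have : (∑' n : ℕ, if (Nat.digits b n).sum = k then apx b J n else 0)
        ≤ ∑' n : ℕ, (1 + 1 / (b : ℝ) ^ J) *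
          (if (Nat.digits b n).sum = k then (1 : ℝ) / n else 0) := by
      refine (hsum J k).tsum_le_tsum (fun n => ?_) ((summ_inv b hb k).mul_left _)
      split_ifs
      · exact apx_le b J n hb
      · simp
    rw [tsum_mul_left] at this
    have h3 := hk.trans_le this
    rw [mul_comm] at h3
    exact lt_of_mul_lt_mul_left h3 hc.le
  · intro a ha
    obtain ⟨J, hJ⟩ := (hDlim.eventually (gt_mem_nhds ha)).exists
    filter_upwards [(hW J).eventually (gt_mem_nhds hJ)] with k hk
    refine lt_of_le_of_lt ((summ_inv b hb k).tsum_le_tsum (fun n => ?_) (hsum J k)) hk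
    split_ifs
    · exact apx_ge b J n hb
    · exact le_rfl
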